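/- Let A be a pre-Lie algebra (As(x,y,z) = As(x,z,y) for all x,y,z) and let B be an associative K-algebra satisfying (x·y)·z = (x·z)·y for all x,y,z. Then the tensor product algebra A⊗B with multiplication (a⊗b)·(a'⊗b') = (a·a')⊗(b·b') is a pre-Lie algebra: As(u,v,w) = As(u,w,v) for all u,v,w in A⊗B. -/

import Mathlib

open TensorProduct

/-- The associator of a bilinear multiplication. -/
def As {K : Type*} [Field K] {A : Type*} [AddCommGroup A] [Module K A]
    (μ : A →ₗ[K] A →ₗ[K] A) (x y z : A) : A :=
  μ (μ x y) z - μ x (μ y z)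

theorem As_add_left {K : Type*} [Field K] {A : Type*} [AddCommGroup A] [Module K A]
    (μ : A →ₗ[K] A →ₗ[K] A) (x x' y z : A) :
    As μ (x + x') y z = As μ x y z + As μ x' y z := by
  simp only [As, map_add, LinearMap.add_apply]
  abel

theorem As_add_middle {K : Type*} [Field K] {A : Type*} [AddCommGroup A] [Module K A]
    (μ : A →ₗ[K] A →ₗ[K] A) (x x' y z : A) :
    As μ y (x + x') z = As μ y x z + As μ y x' z := by
  simp only [As, map_add, LinearMap.add_apply]
  abel

theorem As_add_right {K : Type*} [Field K] {A : Type*} [AddCommGroup A] [Module K A]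
    (μ : A →ₗ[K] A →ₗ[K] A) (x x' y z : A) :
    As μ y z (x + x') = As μ y z x + As μ y z x' := by
  simp only [As, map_add]
  abel

/-- The tensor product of a pre-Lie algebra with an associative algebra
satisfying `(x·y)·z = (x·z)·y` is a pre-Lie algebra. -/
theorem tensor_preLie
    {K : Type*} [Field K]
    {A : Type*} [AddCommGroup A] [Module K A]
    {B : Type*} [AddCommGroup B] [Module K B]
    (μA : A →ₗ[K] A →ₗ[K] A) (μB : B →ₗ[K] B →ₗ[K] B)
    (hA : ∀ x y z : A, As μA x y z = As μA x z y)
    (hBassoc : ∀ x y z : B, μB (μB x y) z = μB x (μB y z))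
    (hBswap : ∀ x y z : B, μB (μB x y) z = μB (μB x z) y)
    (μ : TensorProduct K A B →ₗ[K] TensorProduct K A B →ₗ[K] TensorProduct K A B)
    (hμ : ∀ (a a' : A) (b b' : B),
      μ (a ⊗ₜ[K] b) (a' ⊗ₜ[K] b') = (μA a a') ⊗ₜ[K] (μB b b')) :
    ∀ u v w : TensorProduct K A B, As μ u v w = As μ u w v := by
  have As_tmul (a a' a'' : A) (b b' b'' : B) :
      As μ (a ⊗ₜ[K] b) (a' ⊗ₜ[K] b') (a'' ⊗ₜ[K] b'') =
        As μA a a' a'' ⊗ₜ[K] μB (μB b b') b'' := by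
    simp only [As, hμ, TensorProduct.sub_tmul, hBassoc]
  intro u v w
  induction u with
  | zero => simp [As]
  | add u₁ u₂ h₁ h₂ =>
    rw [As_add_left, As_add_left, h₁, h₂]
  | tmul a b =>
    induction v with
    | zero => simp [As]
    | add v₁ v₂ h₁ h₂ =>
      rw [As_add_middle, As_add_right, h₁, h₂]
    | tmul a' b' =>
      induction w with
      | zero => simp [As]
      | add w₁ w₂ h₁ h₂ =>
        rw [As_add_right, As_add_middle, h₁, h₂]
      | tmul a'' b'' => rw [As_tmul, As_tmul, hA, hBswap]
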